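/- arXiv:1311.7270 — 6 statements merged into one kernel-verified Lean document; each statement's English description precedes it below -/
import Mathlib

section
/- A subalgebra B of L is a CAP-subalgebra of L if and only if there exists a Lie ideal N of L with N ⊆ B such that the image B/N of B in the quotient Lie algebra L/N is a CAP-subalgebra of L/N. -/
section CAP

variable {F : Type*} {L : Type*} [Field F] [LieRing L] [LieAlgebra F L]

/-- `H/K` is a chief factor of `L`: `H`, `K` are Lie ideals with `K < H` and no Lie ideal
lies strictly between `K` and `H`. -/
def IsChiefFactor (H K : LieIdeal F L) : Prop :=
  K < H ∧ ¬∃ J : LieIdeal F L, K < J ∧ J < H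

/-- The subalgebra `U` covers the factor `H/K` if `U + H = U + K`. -/
def Covers (U : LieSubalgebra F L) (H K : LieIdeal F L) : Prop :=
  U.toSubmodule ⊔ H.toSubmodule = U.toSubmodule ⊔ K.toSubmodule

/-- The subalgebra `U` avoids the factor `H/K` if `U ∩ H = U ∩ K`. -/
def Avoids (U : LieSubalgebra F L) (H K : LieIdeal F L) : Prop :=
  U.toSubmodule ⊓ H.toSubmodule = U.toSubmodule ⊓ K.toSubmodule

/-- `U` is a CAP-subalgebra of `L` if it covers or avoids every chief factor of `L`. -/
def IsCAPSubalgebra (U : LieSubalgebra F L) : Prop :=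
  ∀ H K : LieIdeal F L, IsChiefFactor H K → Covers U H K ∨ Avoids U H K

end CAP

/-- The canonical quotient map `L → L ⧸ N` as a morphism of Lie algebras. -/
def quotMk {F : Type*} {L : Type*} [Field F] [LieRing L] [LieAlgebra F L]
    (N : LieIdeal F L) : L →ₗ⁅F⁆ L ⧸ N :=
  { (LieSubmodule.Quotient.mk' N).toLinearMap with
    map_lie' := fun {_ _} => rfl }

theorem isChiefFactor_iff_covBy {F : Type*} {L : Type*} [Field F] [LieRing L] [LieAlgebra F L]
    {H K : LieIdeal F L} : IsChiefFactor H K ↔ K ⋖ H := by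
  simp [IsChiefFactor, CovBy]

section Surjective

variable {F : Type*} {L : Type*} {L' : Type*} [Field F] [LieRing L] [LieAlgebra F L]
  [LieRing L'] [LieAlgebra F L'] {f : L →ₗ⁅F⁆ L'}

theorem LieIdeal.map_comap_of_surjective (hf : Function.Surjective f) (J : LieIdeal F L') :
    (J.comap f).map f = J := by
  rw [LieIdeal.map_comap_eq (f.isIdealMorphism_of_surjective hf),
    f.idealRange_eq_top_of_surjective hf, top_inf_eq]

theorem LieIdeal.comap_map_of_surjective (hf : Function.Surjective f) (I : LieIdeal F L) :
    (I.map f).comap f = I ⊔ f.ker := by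
  apply LieIdeal.comap_map_eq
  exact congrArg (fun S : Submodule F L' ↦ (S : Set L')) (LieIdeal.coe_map_of_surjective hf)

/-- Pulling back Lie ideals along a surjective morphism is an order embedding. -/
def LieIdeal.comapOrderEmbedding (hf : Function.Surjective f) :
    LieIdeal F L' ↪o LieIdeal F L :=
  OrderEmbedding.ofMapLEIff (LieIdeal.comap f) fun I J ↦
    ⟨fun h ↦ by
      rw [← LieIdeal.map_comap_of_surjective hf I]
      exact LieIdeal.map_le_iff_le_comap.2 h, fun h ↦ LieIdeal.comap_mono h⟩

theorem LieIdeal.comap_covBy_comap_iff (hf : Function.Surjective f) {K H : LieIdeal F L'} :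
    K.comap f ⋖ H.comap f ↔ K ⋖ H := by
  refine Set.OrdConnected.apply_covBy_apply_iff (LieIdeal.comapOrderEmbedding hf) ⟨?_⟩
  rintro _ ⟨I, rfl⟩ _ - J ⟨hJ, -⟩
  refine ⟨J.map f, ?_⟩
  change (J.map f).comap f = J
  rw [LieIdeal.comap_map_of_surjective hf, sup_eq_left]
  exact (f.ker_le_comap I).trans hJ

variable {B : LieSubalgebra F L}

theorem comap_map_toSubmodule_of_ker_le (hB : f.ker.toSubmodule ≤ B.toSubmodule) :
    ((B.map f).toSubmodule).comap (f : L →ₗ[F] L') = B.toSubmodule :=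
  Submodule.comap_map_eq_self (p := B.toSubmodule) (f := (f : L →ₗ[F] L')) hB

theorem covers_map_iff (hf : Function.Surjective f) (hB : f.ker.toSubmodule ≤ B.toSubmodule)
    (H K : LieIdeal F L') :
    Covers (B.map f) H K ↔ Covers B (H.comap f) (K.comap f) := by
  have hmap (J : LieIdeal F L') : (B.toSubmodule ⊔ (J.comap f).toSubmodule).map (f : L →ₗ[F] L') =
      (B.map f).toSubmodule ⊔ J.toSubmodule := by
    rw [Submodule.map_sup, LieIdeal.comap_toSubmodule,
      Submodule.map_comap_eq_of_surjective (f := (f : L →ₗ[F] L')) hf]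
    rfl
  have hcomap (J : LieIdeal F L') : ((B.map f).toSubmodule ⊔ J.toSubmodule).comap
      (f : L →ₗ[F] L') = B.toSubmodule ⊔ (J.comap f).toSubmodule := by
    rw [← hmap]
    exact Submodule.comap_map_eq_self (f := (f : L →ₗ[F] L')) (hB.trans le_sup_left)
  unfold Covers
  rw [← hcomap, ← hcomap]
  exact (Submodule.comap_injective_of_surjective (f := (f : L →ₗ[F] L')) hf).eq_iff.symm

theorem avoids_map_iff (hf : Function.Surjective f) (hB : f.ker.toSubmodule ≤ B.toSubmodule)
    (H K : LieIdeal F L') :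
    Avoids (B.map f) H K ↔ Avoids B (H.comap f) (K.comap f) := by
  unfold Avoids
  rw [← comap_map_toSubmodule_of_ker_le hB, LieIdeal.comap_toSubmodule, LieIdeal.comap_toSubmodule,
    ← Submodule.comap_inf, ← Submodule.comap_inf]
  exact (Submodule.comap_injective_of_surjective (f := (f : L →ₗ[F] L')) hf).eq_iff.symm

theorem IsCAPSubalgebra.map_of_surjective (hf : Function.Surjective f)
    (hB : f.ker.toSubmodule ≤ B.toSubmodule) (h : IsCAPSubalgebra B) :
    IsCAPSubalgebra (B.map f) := by
  intro H K hHK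
  rw [covers_map_iff hf hB, avoids_map_iff hf hB]
  rw [isChiefFactor_iff_covBy, ← LieIdeal.comap_covBy_comap_iff hf] at hHK
  exact h _ _ (isChiefFactor_iff_covBy.2 hHK)

theorem IsCAPSubalgebra.of_map_of_surjective (hf : Function.Surjective f)
    (hB : f.ker.toSubmodule ≤ B.toSubmodule) (h : IsCAPSubalgebra (B.map f)) :
    IsCAPSubalgebra B := by
  intro H K hHK
  rw [isChiefFactor_iff_covBy] at hHK
  have hKH : K.toSubmodule ≤ H.toSubmodule := hHK.le
  obtain hinf | hinf := hHK.eq_or_eq (c := H ⊓ (K ⊔ f.ker)) (le_inf hHK.le le_sup_left) inf_le_left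
  · have hcov : K ⊔ f.ker ⋖ H ⊔ f.ker := by
      have := covBy_sup_of_inf_covBy_left (a := H) (b := K ⊔ f.ker) (by rwa [hinf])
      rwa [← sup_assoc, sup_eq_left.2 hHK.le] at this
    rw [← LieIdeal.comap_map_of_surjective hf, ← LieIdeal.comap_map_of_surjective hf,
      LieIdeal.comap_covBy_comap_iff hf, ← isChiefFactor_iff_covBy] at hcov
    have hCA := h _ _ hcov
    rw [covers_map_iff hf hB, avoids_map_iff hf hB, LieIdeal.comap_map_of_surjective hf,
      LieIdeal.comap_map_of_surjective hf] at hCA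
    refine hCA.imp (fun hC ↦ ?_) fun hA ↦ ?_
    · have hsup (J : LieIdeal F L) : B.toSubmodule ⊔ (J ⊔ f.ker).toSubmodule =
          B.toSubmodule ⊔ J.toSubmodule := by
        rw [LieSubmodule.sup_toSubmodule, sup_comm J.toSubmodule, ← sup_assoc, sup_eq_left.2 hB]
      rwa [Covers, hsup, hsup] at hC
    · refine le_antisymm (le_inf inf_le_left ?_) (inf_le_inf_left _ hKH)
      intro x hx
      have hxH : x ∈ H := hx.2
      have hx' : x ∈ B.toSubmodule ⊓ (K ⊔ f.ker).toSubmodule := by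
        rw [← hA]
        exact ⟨hx.1, (le_sup_left : H ≤ H ⊔ f.ker) hxH⟩
      have : x ∈ H ⊓ (K ⊔ f.ker) := ⟨hxH, hx'.2⟩
      rwa [hinf] at this
  · left
    have hle : H.toSubmodule ≤ (K ⊔ f.ker).toSubmodule :=
      (inf_eq_left (a := H) (b := K ⊔ f.ker)).1 hinf
    rw [LieSubmodule.sup_toSubmodule] at hle
    exact le_antisymm
      (sup_le le_sup_left (hle.trans (sup_le le_sup_right (hB.trans le_sup_left))))
      (sup_le_sup_left hKH _)

end Surjective

theorem quotMk_surjective {F : Type*} {L : Type*} [Field F] [LieRing L] [LieAlgebra F L]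
    (N : LieIdeal F L) : Function.Surjective (quotMk N) :=
  LieSubmodule.Quotient.surjective_mk' N

theorem ker_quotMk {F : Type*} {L : Type*} [Field F] [LieRing L] [LieAlgebra F L]
    (N : LieIdeal F L) : (quotMk N).ker = N := by
  ext x
  rw [LieHom.mem_ker]
  exact LieSubmodule.Quotient.mk_eq_zero (N := N)

/-- `B` is a CAP-subalgebra of `L` iff there is a Lie ideal `N` of `L` contained in `B` such
that the image `B/N` of `B` in `L ⧸ N` is a CAP-subalgebra of `L ⧸ N`. -/
theorem stmt2 {F : Type*} {L : Type*} [Field F] [LieRing L] [LieAlgebra F L]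
    [FiniteDimensional F L] (B : LieSubalgebra F L) :
    IsCAPSubalgebra B ↔
      ∃ N : LieIdeal F L, N.toSubmodule ≤ B.toSubmodule ∧
        IsCAPSubalgebra (B.map (quotMk N)) := by
  constructor
  · intro h
    have hker : (quotMk (⊥ : LieIdeal F L)).ker.toSubmodule ≤ B.toSubmodule := by
      simp [ker_quotMk]
    exact ⟨⊥, by simp, h.map_of_surjective (quotMk_surjective ⊥) hker⟩
  · rintro ⟨N, hN, h⟩
    exact h.of_map_of_surjective (quotMk_surjective N) (by rwa [ker_quotMk])
end

section
/- Let L be a finite-dimensional Lie algebra, let B be a Lie ideal of L, and let U be a subalgebra of L with L = B + U. If B^k ⊆ U for some natural number k ≥ 1, where B^k denotes the k-th term of the lower central series of the ideal B (B^1 = B, B^{i+1} = [B, B^i]), then U is a CAP-subalgebra of L. -/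
/-- The terms of the lower central series of an ideal `B`: `idealLCS B 0 = B` and
`idealLCS B (k+1) = ⁅B, idealLCS B k⁆`; so `B^k = idealLCS B (k-1)` for `k ≥ 1`. -/
def idealLCS {F : Type*} {L : Type*} [Field F] [LieRing L] [LieAlgebra F L]
    (B : LieIdeal F L) : ℕ → LieIdeal F L
  | 0 => B
  | (k + 1) => ⁅B, idealLCS B k⁆

section ChiefFactors

variable {F : Type*} {L : Type*} [Field F] [LieRing L] [LieAlgebra F L]

/-- An ideal `J` between `K` and `H` is one of the two if `H/K` is a chief factor. -/
lemma IsChiefFactor.eq_or_eq {H K J : LieIdeal F L} (hc : IsChiefFactor H K)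
    (hKJ : K ≤ J) (hJH : J ≤ H) : J = K ∨ J = H := by
  by_contra! hne
  exact hc.2 ⟨J, lt_of_le_of_ne hKJ hne.1.symm, lt_of_le_of_ne hJH hne.2⟩

lemma covers_of_le {U : LieSubalgebra F L} {H K : LieIdeal F L} (hKH : K ≤ H)
    (h : H.toSubmodule ≤ U.toSubmodule ⊔ K.toSubmodule) : Covers U H K :=
  le_antisymm (sup_le le_sup_left h)
    (sup_le_sup_left ((LieSubmodule.toSubmodule_le_toSubmodule _ _).2 hKH) _)

lemma avoids_of_le {U : LieSubalgebra F L} {H K : LieIdeal F L} (hKH : K ≤ H)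
    (h : U.toSubmodule ⊓ H.toSubmodule ≤ K.toSubmodule) : Avoids U H K :=
  le_antisymm (le_inf inf_le_left h)
    (inf_le_inf_left _ ((LieSubmodule.toSubmodule_le_toSubmodule _ _).2 hKH))

/-- If `L = B + U` and `B` acts trivially on `H/K`, then `(U ∩ H) + K` is an ideal of `L`. -/
lemma exists_lieIdeal_toSubmodule_eq {B H K : LieIdeal F L} {U : LieSubalgebra F L}
    (hsup : B.toSubmodule ⊔ U.toSubmodule = ⊤) (hB : ⁅B, H⁆ ≤ K) :
    ∃ J : LieIdeal F L, J.toSubmodule = (U.toSubmodule ⊓ H.toSubmodule) ⊔ K.toSubmodule := by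
  refine ⟨⟨(U.toSubmodule ⊓ H.toSubmodule) ⊔ K.toSubmodule, ?_⟩, rfl⟩
  intro x m hm
  obtain ⟨b, hb, u, hu, rfl⟩ := Submodule.mem_sup.1 (hsup ▸ Submodule.mem_top : x ∈ _)
  obtain ⟨y, ⟨hyU, hyH⟩, z, hz, rfl⟩ := Submodule.mem_sup.1 hm
  have hby : ⁅b, y⁆ ∈ K := hB (LieSubmodule.lie_mem_lie hb hyH)
  have huy : ⁅u, y⁆ ∈ U.toSubmodule ⊓ H.toSubmodule :=
    ⟨U.lie_mem hu hyU, H.lie_mem hyH⟩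
  refine Submodule.mem_sup.2 ⟨⁅u, y⁆, huy, ⁅b, y⁆ + ⁅b + u, z⁆, ?_, ?_⟩
  · exact K.add_mem hby (K.lie_mem hz)
  · rw [lie_add, add_lie b u y]
    abel

/-- If `L = B + U` and `B` acts trivially on the chief factor `H/K`, then `U` covers or avoids
`H/K`. -/
lemma covers_or_avoids_of_lie_le {B H K : LieIdeal F L} {U : LieSubalgebra F L}
    (hc : IsChiefFactor H K) (hsup : B.toSubmodule ⊔ U.toSubmodule = ⊤) (hB : ⁅B, H⁆ ≤ K) :
    Covers U H K ∨ Avoids U H K := by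
  obtain ⟨J, hJ⟩ := exists_lieIdeal_toSubmodule_eq hsup hB
  have hKJ : K ≤ J := by
    rw [← LieSubmodule.toSubmodule_le_toSubmodule, hJ]
    exact le_sup_right
  have hJH : J ≤ H := by
    rw [← LieSubmodule.toSubmodule_le_toSubmodule, hJ]
    exact sup_le inf_le_right ((LieSubmodule.toSubmodule_le_toSubmodule _ _).2 hc.1.le)
  rcases hc.eq_or_eq hKJ hJH with rfl | rfl
  · exact .inr (avoids_of_le hc.1.le (le_sup_left.trans hJ.ge))
  · exact .inl (covers_of_le hc.1.le (hJ.le.trans (sup_le_sup_right inf_le_left _)))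

end ChiefFactors

/-- If `H = K + [B, H]`, then `H` is contained in `K` plus any term of the lower central series
of `B`. -/
lemma le_sup_idealLCS {F : Type*} {L : Type*} [Field F] [LieRing L] [LieAlgebra F L]
    {B H K : LieIdeal F L} (h : H ≤ K ⊔ ⁅B, H⁆) (n : ℕ) : H ≤ K ⊔ idealLCS B n := by
  induction n with
  | zero => exact h.trans (sup_le_sup_left (LieSubmodule.lie_le_left B H) K)
  | succ n ih =>
    refine h.trans (sup_le le_sup_left ?_)
    refine (LieSubmodule.mono_lie_right B ih).trans ?_
    rw [LieSubmodule.lie_sup]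
    exact sup_le_sup_right (LieSubmodule.lie_le_right K B) _

/-- If `U` is a supplement to an ideal `B` in `L` and `B^k ⊆ U` for some `k ≥ 1`, then `U`
is a CAP-subalgebra of `L`. -/
theorem stmt6 {F : Type*} {L : Type*} [Field F] [LieRing L] [LieAlgebra F L]
    [FiniteDimensional F L] (B : LieIdeal F L) (U : LieSubalgebra F L)
    (hsup : B.toSubmodule ⊔ U.toSubmodule = ⊤)
    (h : ∃ k : ℕ, 1 ≤ k ∧ (idealLCS B (k - 1)).toSubmodule ≤ U.toSubmodule) :
    IsCAPSubalgebra U := by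
  obtain ⟨k, -, hk⟩ := h
  intro H K hc
  rcases hc.eq_or_eq (le_sup_left : K ≤ K ⊔ ⁅B, H⁆)
    (sup_le hc.1.le (LieSubmodule.lie_le_right H B)) with hJ | hJ
  · exact covers_or_avoids_of_lie_le hc hsup (sup_eq_left.1 hJ)
  · left
    have hle : H.toSubmodule ≤ (K ⊔ idealLCS B (k - 1)).toSubmodule :=
      le_sup_idealLCS hJ.ge (k - 1)
    rw [LieSubmodule.sup_toSubmodule] at hle
    exact covers_of_le hc.1.le (hle.trans (sup_le le_sup_right (hk.trans le_sup_left)))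
end

section
/- Let U be a CAP-subalgebra of L and let B be a Lie ideal of L. Then B + U is a CAP-subalgebra of L. -/
theorem LieSubalgebra.toSubmodule_lieIdeal_sup {R L : Type*} [CommRing R] [LieRing L]
    [LieAlgebra R L] (B : LieIdeal R L) (U : LieSubalgebra R L) :
    ((B : LieSubalgebra R L) ⊔ U).toSubmodule = B.toSubmodule ⊔ U.toSubmodule := by
  apply le_antisymm
  · let S : LieSubalgebra R L :=
      { B.toSubmodule ⊔ U.toSubmodule with
        lie_mem' := by
          intro x y hx hy
          obtain ⟨b, hb, u, hu, rfl⟩ := Submodule.mem_sup.mp hx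
          obtain ⟨c, hc, v, hv, rfl⟩ := Submodule.mem_sup.mp hy
          refine Submodule.mem_sup.mpr
            ⟨⁅b, c + v⁆ + ⁅u, c⁆, ?_, ⁅u, v⁆, U.lie_mem hu hv, ?_⟩
          · exact add_mem (lie_mem_left R L B b (c + v) hb) (lie_mem_right R L B u c hc)
          · simp only [add_lie, lie_add]
            abel }
    have h : (B : LieSubalgebra R L) ⊔ U ≤ S :=
      sup_le (fun _ hx => Submodule.mem_sup_left hx) (fun _ hx => Submodule.mem_sup_right hx)
    exact h
  · refine sup_le ?_ ?_
    · exact (le_sup_left : (B : LieSubalgebra R L) ≤ (B : LieSubalgebra R L) ⊔ U)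
    · exact (le_sup_right : U ≤ (B : LieSubalgebra R L) ⊔ U)

theorem IsChiefFactor.sup_left {F L : Type*} [Field F] [LieRing L] [LieAlgebra F L]
    {H K : LieIdeal F L} (h : IsChiefFactor H K) (B : LieIdeal F L) (hB : B ⊔ H ≠ B ⊔ K) :
    IsChiefFactor (B ⊔ H) (B ⊔ K) := by
  refine ⟨lt_of_le_of_ne (sup_le_sup_left h.1.le B) hB.symm, ?_⟩
  rintro ⟨J, hKJ, hJH⟩
  have hJ : B ⊔ H ⊓ J = J := by
    rw [← sup_inf_assoc_of_le H (le_sup_left.trans hKJ.le), inf_eq_right.mpr hJH.le]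
  have hK : K ≤ H ⊓ J := le_inf h.1.le (le_sup_right.trans hKJ.le)
  refine h.2 ⟨H ⊓ J, lt_of_le_of_ne hK ?_, lt_of_le_of_ne inf_le_left ?_⟩
  · intro e
    rw [← e] at hJ
    exact hKJ.ne hJ
  · intro e
    rw [e] at hJ
    exact hJH.ne hJ.symm

theorem sup_inf_eq_of_inf_sup_eq {α : Type*} [Lattice α] [IsModularLattice α]
    {u b h k : α} (hkh : k ≤ h) (hu : u ⊓ (b ⊔ h) = u ⊓ (b ⊔ k)) (hb : b ⊓ h ≤ k) :
    (b ⊔ u) ⊓ h = (b ⊔ u) ⊓ k := by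
  refine le_antisymm (le_inf inf_le_left ?_) (inf_le_inf_left _ hkh)
  calc (b ⊔ u) ⊓ h ≤ (b ⊔ u) ⊓ (b ⊔ h) ⊓ h :=
        le_inf (inf_le_inf_left _ le_sup_right) inf_le_right
    _ = (b ⊔ u ⊓ (b ⊔ k)) ⊓ h := by rw [sup_inf_assoc_of_le u le_sup_left, hu]
    _ ≤ (k ⊔ b) ⊓ h := inf_le_inf_right _ (sup_le le_sup_right (by
        rw [sup_comm k b]; exact inf_le_right))
    _ = k ⊔ b ⊓ h := sup_inf_assoc_of_le b hkh
    _ ≤ k := sup_le le_rfl hb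

/-- If `U` is a CAP-subalgebra of `L` and `B` is a Lie ideal of `L`, then `B + U` is a
CAP-subalgebra of `L`. -/
theorem stmt7 {F : Type*} {L : Type*} [Field F] [LieRing L] [LieAlgebra F L]
    [FiniteDimensional F L] (U : LieSubalgebra F L) (hU : IsCAPSubalgebra U)
    (B : LieIdeal F L) :
    IsCAPSubalgebra ((B : LieSubalgebra F L) ⊔ U) := by
  intro H K h
  unfold Covers Avoids
  rw [LieSubalgebra.toSubmodule_lieIdeal_sup]
  by_cases hB : B ⊔ H = B ⊔ K
  · left
    have e := congrArg LieSubmodule.toSubmodule hB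
    simp only [LieSubmodule.sup_toSubmodule] at e
    rw [sup_right_comm, e, sup_right_comm]
  · rcases hU _ _ (h.sup_left B hB) with hc | ha
    · left
      simp only [Covers, LieSubmodule.sup_toSubmodule] at hc
      rw [sup_comm B.toSubmodule, sup_assoc, hc, sup_assoc]
    · right
      simp only [Avoids, LieSubmodule.sup_toSubmodule] at ha
      refine sup_inf_eq_of_inf_sup_eq h.1.le ha ?_
      have hBK : B ⊓ H ≤ K := by
        by_contra hn
        have hlt : K < K ⊔ B ⊓ H := left_lt_sup.mpr hn
        have hle : K ⊔ B ⊓ H ≤ H := sup_le h.1.le inf_le_right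
        have heq : K ⊔ B ⊓ H = H := by
          by_contra hne
          exact h.2 ⟨_, hlt, lt_of_le_of_ne hle hne⟩
        apply hB
        refine le_antisymm (sup_le le_sup_left ?_) (sup_le_sup_left h.1.le B)
        rw [← heq]
        exact sup_le le_sup_right (inf_le_left.trans le_sup_left)
      exact hBK
end

section
/- Let U be a CAP-subalgebra of L, let 0 = A_0 < A_1 < ... < A_n = L be a chief series for L (a chain of Lie ideals of L in which each A_i/A_{i-1} is a chief factor of L), and let I = {i : 1 ≤ i ≤ n, U covers A_i/A_{i-1}}. Then dim U = Σ_{i ∈ I} (dim A_i − dim A_{i-1}). -/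
theorem Fin.last_eq_zero_add_sum {M : Type*} [AddCommMonoid M] {n : ℕ} (f : Fin (n + 1) → M)
    (g : Fin n → M) (h : ∀ i, f i.succ = f i.castSucc + g i) :
    f (Fin.last n) = f 0 + ∑ i, g i := by
  induction n with
  | zero => simp
  | succ n ih =>
    rw [Fin.sum_univ_castSucc, ← add_assoc, ← Fin.succ_last, h]
    congr 1
    exact ih (fun i => f i.castSucc) (fun i => g i.castSucc) fun i => h i.castSucc

theorem Covers.finrank_inf {F L : Type*} [Field F] [LieRing L] [LieAlgebra F L]
    [FiniteDimensional F L] {U : LieSubalgebra F L} {H K : LieIdeal F L}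
    (h : Covers U H K) (hKH : K ≤ H) :
    Module.finrank F ↥(U.toSubmodule ⊓ H.toSubmodule) =
      Module.finrank F ↥(U.toSubmodule ⊓ K.toSubmodule) +
        (Module.finrank F H - Module.finrank F K) := by
  have hH := Submodule.finrank_sup_add_finrank_inf_eq U.toSubmodule H.toSubmodule
  have hK := Submodule.finrank_sup_add_finrank_inf_eq U.toSubmodule K.toSubmodule
  have hle : Module.finrank F K.toSubmodule ≤ Module.finrank F H.toSubmodule :=
    Submodule.finrank_mono hKH
  unfold Covers at h
  rw [h] at hH
  change _ = _ + (Module.finrank F H.toSubmodule - Module.finrank F K.toSubmodule)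
  omega

open scoped Classical in
/-- The dimension of a CAP-subalgebra `U` equals the sum of the dimensions of the chief
factors in a chief series of `L` that `U` covers. -/
theorem stmt8 {F : Type*} {L : Type*} [Field F] [LieRing L] [LieAlgebra F L]
    [FiniteDimensional F L] (U : LieSubalgebra F L) (hU : IsCAPSubalgebra U)
    (n : ℕ) (A : Fin (n + 1) → LieIdeal F L)
    (h0 : A 0 = ⊥) (hn : A (Fin.last n) = ⊤)
    (hcf : ∀ i : Fin n, IsChiefFactor (A i.succ) (A i.castSucc)) :
    Module.finrank F U =
      ∑ i : Fin n,
        if Covers U (A i.succ) (A i.castSucc) then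
          Module.finrank F (A i.succ) - Module.finrank F (A i.castSucc)
        else 0 := by
  have key := Fin.last_eq_zero_add_sum
    (fun i => Module.finrank F ↥(U.toSubmodule ⊓ (A i).toSubmodule))
    (fun i : Fin n => if Covers U (A i.succ) (A i.castSucc) then
      Module.finrank F (A i.succ) - Module.finrank F (A i.castSucc) else 0) fun i => by
    split_ifs with hc
    · exact hc.finrank_inf (hcf i).1.le
    · rw [((hU _ _ (hcf i)).resolve_left hc : U.toSubmodule ⊓ _ = _), add_zero]
  rw [h0, hn, LieSubmodule.top_toSubmodule, LieSubmodule.bot_toSubmodule, inf_top_eq,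
    inf_bot_eq, finrank_bot, zero_add] at key
  exact key
end

section
/- Let H/K be a chief factor of L. Then every one-dimensional subalgebra of L covers or avoids H/K if and only if dim(H/K) = 1, i.e. dim H = dim K + 1. -/
/-- The line through a vector, as a Lie subalgebra. -/
def LieSubalgebra.line (F : Type*) {L : Type*} [Field F] [LieRing L] [LieAlgebra F L] (x : L) :
    LieSubalgebra F L where
  __ := F ∙ x
  lie_mem' := by
    intro a b ha hb
    obtain ⟨r, rfl⟩ := Submodule.mem_span_singleton.mp ha
    obtain ⟨s, rfl⟩ := Submodule.mem_span_singleton.mp hb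
    simp

/-- Every one-dimensional subalgebra of `L` covers or avoids the chief factor `H/K` iff
`H/K` is one-dimensional. -/
theorem stmt9 {F : Type*} {L : Type*} [Field F] [LieRing L] [LieAlgebra F L]
    [FiniteDimensional F L] (H K : LieIdeal F L) (hHK : IsChiefFactor H K) :
    (∀ U : LieSubalgebra F L, Module.finrank F U = 1 → Covers U H K ∨ Avoids U H K) ↔
      Module.finrank F H = Module.finrank F K + 1 := by
  obtain ⟨hlt, -⟩ := hHK
  have hle : K.toSubmodule ≤ H.toSubmodule := hlt.le
  constructor
  · intro hcap
    obtain ⟨x, hxH, hxK⟩ := SetLike.exists_of_lt hlt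
    have hx0 : x ≠ 0 := fun h => hxK (h ▸ K.zero_mem)
    have hspan : F ∙ x ≤ H.toSubmodule := (Submodule.span_singleton_le_iff_mem _ _).mpr hxH
    have hfin := Submodule.finrank_sup_span_singleton (p := K.toSubmodule) hxK
    rcases hcap (LieSubalgebra.line F x) (finrank_span_singleton hx0) with hc | ha
    · change F ∙ x ⊔ H.toSubmodule = F ∙ x ⊔ K.toSubmodule at hc
      rw [sup_comm, ← hc, sup_eq_right.mpr hspan] at hfin
      exact hfin
    · have hmem : x ∈ F ∙ x ⊓ H.toSubmodule := ⟨Submodule.mem_span_singleton_self x, hxH⟩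
      change F ∙ x ⊓ H.toSubmodule = F ∙ x ⊓ K.toSubmodule at ha
      exact absurd (ha ▸ hmem).2 hxK
  · intro hfin U _
    by_cases hUK : U.toSubmodule ⊓ H.toSubmodule ≤ K.toSubmodule
    · exact .inr (le_antisymm (le_inf inf_le_left hUK) (inf_le_inf_left _ hle))
    · obtain ⟨x, ⟨hxU, hxH⟩, hxK⟩ := SetLike.not_le_iff_exists.mp hUK
      have hH : K.toSubmodule ⊔ F ∙ x = H.toSubmodule :=
        Submodule.eq_of_le_of_finrank_eq
          (sup_le hle ((Submodule.span_singleton_le_iff_mem _ _).mpr hxH))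
          ((Submodule.finrank_sup_span_singleton (p := K.toSubmodule) hxK).trans hfin.symm)
      refine .inl (le_antisymm (sup_le le_sup_left ?_) (sup_le_sup_left hle _))
      rw [← hH]
      exact sup_le le_sup_right
        (((Submodule.span_singleton_le_iff_mem _ _).mpr hxU).trans le_sup_left)
end

section
/- If L is a supersolvable finite-dimensional Lie algebra, then every subalgebra of L is a CAP-subalgebra of L. -/
/-- If `L` is supersolvable (every chief factor is one-dimensional), then every subalgebra
of `L` is a CAP-subalgebra of `L`. -/
theorem stmt11 {F : Type*} {L : Type*} [Field F] [LieRing L] [LieAlgebra F L]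
    [FiniteDimensional F L]
    (hss : ∀ H K : LieIdeal F L, IsChiefFactor H K →
      Module.finrank F H = Module.finrank F K + 1)
    (U : LieSubalgebra F L) :
    IsCAPSubalgebra U := by
  intro H K hHK
  have hKH : K.toSubmodule ≤ H.toSubmodule := hHK.1.le
  by_cases hle : U.toSubmodule ⊓ H.toSubmodule ≤ K.toSubmodule
  · exact Or.inr (le_antisymm (le_inf inf_le_left hle) (inf_le_inf_left _ hKH))
  · left
    have hlt : K.toSubmodule < K.toSubmodule ⊔ U.toSubmodule ⊓ H.toSubmodule :=
      left_lt_sup.mpr hle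
    have hrank : Module.finrank F H.toSubmodule = Module.finrank F K.toSubmodule + 1 :=
      hss H K hHK
    have heq : K.toSubmodule ⊔ U.toSubmodule ⊓ H.toSubmodule = H.toSubmodule :=
      Submodule.eq_of_le_of_finrank_le (sup_le hKH inf_le_right)
        (hrank.trans_le (Submodule.finrank_lt_finrank_of_lt hlt))
    refine le_antisymm (sup_le le_sup_left ?_) (sup_le_sup_left hKH _)
    rw [← heq]
    exact sup_le le_sup_right (inf_le_left.trans le_sup_left)
end
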